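/- For each i = 1, 2, ..., s let I_i be a squarefree monomial ideal of the form I_i = (x^{(i)}_{11}, ..., x^{(i)}_{1 h_1^{(i)}}) ∩ ... ∩ (x^{(i)}_{q^{(i)} 1}, ..., x^{(i)}_{q^{(i)} h_{q^{(i)}}^{(i)}}) in a polynomial ring R over a field K whose variables include all x^{(i)}_{jk}, and suppose that no variable appears in the minimal monomial generating sets of two different ideals I_i and I_j (i ≠ j). For each i and each ℓ = 0, 1, ..., h_1^{(i)} + ... + h_{q^{(i)}}^{(i)} − q^{(i)}, set g_ℓ^{(i)} = Σ x^{(i)}_{1ℓ_1} x^{(i)}_{2ℓ_2} ⋯ x^{(i)}_{q^{(i)} ℓ_{q^{(i)}}}, summed over all tuples with 1 ≤ ℓ_j ≤ h_j^{(i)} and ℓ_1 + ... + ℓ_{q^{(i)}} = ℓ + q^{(i)}. Then the ideal generated by all the elements g_ℓ^{(i)} (for i = 1, ..., s and ℓ = 0, 1, ..., h_1^{(i)}+...+h_{q^{(i)}}^{(i)} − q^{(i)}) is a reduction of I_1 + I_2 + ... + I_s. -/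

import Mathlib

namespace Ideal

variable {R : Type*} [CommRing R]

theorem sup_pow_succ_le (A B : Ideal R) (n : ℕ) :
    (A ⊔ B) ^ (n + 1) ≤ A ^ (n + 1) ⊔ B * (A ⊔ B) ^ n := by
  induction n with
  | zero => simp
  | succ n ih =>
    calc (A ⊔ B) ^ (n + 1 + 1) = A * (A ⊔ B) ^ (n + 1) ⊔ B * (A ⊔ B) ^ (n + 1) := by
          rw [pow_succ', Ideal.sup_mul]
      _ ≤ A * (A ^ (n + 1) ⊔ B * (A ⊔ B) ^ n) ⊔ B * (A ⊔ B) ^ (n + 1) :=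
          sup_le_sup_right (mul_mono_right ih) _
      _ ≤ A ^ (n + 1 + 1) ⊔ B * (A ⊔ B) ^ (n + 1) := by
          rw [Ideal.mul_sup, ← pow_succ']
          refine sup_le (sup_le le_sup_left (le_sup_of_le_right ?_)) le_sup_right
          rw [mul_left_comm, pow_succ' (A ⊔ B)]
          exact mul_mono_right (mul_mono_left le_sup_left)

/-- `J` is a reduction of `I`; any exponent is allowed, since it can always be increased. -/
def IsReductionOf (J I : Ideal R) : Prop :=
  J ≤ I ∧ ∃ t : ℕ, I ^ (t + 1) ≤ J * I ^ t

namespace IsReductionOf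

variable {I J L : Ideal R}

theorem refl (I : Ideal R) : IsReductionOf I I :=
  ⟨le_rfl, 0, by simp⟩

theorem trans (hJL : IsReductionOf J L) (hLI : IsReductionOf L I) : IsReductionOf J I := by
  obtain ⟨hJ, m, hm⟩ := hJL
  obtain ⟨hL, n, hn⟩ := hLI
  have key : ∀ k, I ^ (n + k) ≤ L ^ k * I ^ n := by
    intro k
    induction k with
    | zero => simp
    | succ k ih =>
      calc I ^ (n + (k + 1)) = I ^ (n + k) * I := by rw [← add_assoc, pow_succ]
        _ ≤ L ^ k * I ^ n * I := mul_mono_left ih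
        _ = L ^ k * I ^ (n + 1) := by rw [mul_assoc, pow_succ]
        _ ≤ L ^ k * (L * I ^ n) := mul_mono_right hn
        _ = L ^ (k + 1) * I ^ n := by rw [pow_succ, mul_assoc]
  refine ⟨hJ.trans hL, m + n, ?_⟩
  calc I ^ (m + n + 1) = I ^ (n + (m + 1)) := by congr 1; ring
    _ ≤ L ^ (m + 1) * I ^ n := key _
    _ ≤ J * L ^ m * I ^ n := mul_mono_left hm
    _ ≤ J * I ^ m * I ^ n := mul_mono_left (mul_mono_right (pow_right_mono hL m))
    _ = J * I ^ (m + n) := by rw [mul_assoc, pow_add]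

theorem mul_left (h : IsReductionOf J I) (M : Ideal R) : IsReductionOf (M * J) (M * I) := by
  obtain ⟨hJ, t, ht⟩ := h
  refine ⟨mul_mono_right hJ, t, ?_⟩
  calc (M * I) ^ (t + 1) = M ^ (t + 1) * I ^ (t + 1) := mul_pow _ _ _
    _ ≤ M ^ (t + 1) * (J * I ^ t) := mul_mono_right ht
    _ = M * J * (M * I) ^ t := by rw [mul_pow]; ring

theorem sup_right (h : IsReductionOf J I) (M : Ideal R) : IsReductionOf (J ⊔ M) (I ⊔ M) := by
  obtain ⟨hJ, t, ht⟩ := h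
  refine ⟨sup_le_sup_right hJ M, t, (sup_pow_succ_le I M t).trans ?_⟩
  rw [Ideal.sup_mul]
  exact sup_le_sup_right (ht.trans (mul_mono_right (pow_right_mono le_sup_left t))) _

theorem sup {J₁ I₁ J₂ I₂ : Ideal R} (h₁ : IsReductionOf J₁ I₁) (h₂ : IsReductionOf J₂ I₂) :
    IsReductionOf (J₁ ⊔ J₂) (I₁ ⊔ I₂) := by
  refine (h₁.sup_right J₂).trans ?_
  simpa only [sup_comm I₁] using h₂.sup_right I₁

theorem sum {ι : Type*} {J I : ι → Ideal R} (s : Finset ι)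
    (h : ∀ i ∈ s, IsReductionOf (J i) (I i)) : IsReductionOf (∑ i ∈ s, J i) (∑ i ∈ s, I i) := by
  classical
  induction s using Finset.induction_on with
  | empty => simpa using refl _
  | insert a s ha ih =>
    rw [Finset.sum_insert ha, Finset.sum_insert ha]
    exact (h a (Finset.mem_insert_self a s)).sup
      (ih fun i hi => h i (Finset.mem_insert_of_mem hi))

theorem exists_pow_succ_eq (h : IsReductionOf J I) :
    ∃ t : ℕ, 1 ≤ t ∧ I ^ (t + 1) = J * I ^ t := by
  obtain ⟨hJ, t, ht⟩ := h
  refine ⟨t + 1, Nat.le_add_left 1 t, le_antisymm ?_ ?_⟩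
  · rw [pow_succ I (t + 1), pow_succ I t, ← mul_assoc, ← pow_succ]
    exact mul_mono_left ht
  · rw [pow_succ' I (t + 1)]
    exact mul_mono_left hJ

end IsReductionOf

end Ideal

namespace Polynomial

open Ideal

variable {R : Type*} [CommRing R]

theorem contentIdeal_le_iff {p : R[X]} {I : Ideal R} :
    p.contentIdeal ≤ I ↔ ∀ n, p.coeff n ∈ I := by
  refine ⟨fun h n => h (p.coeff_mem_contentIdeal n), fun h => span_le.2 fun r hr => ?_⟩
  obtain ⟨n, -, rfl⟩ := mem_coeffs_iff.1 hr
  exact h n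

theorem contentIdeal_add_le (p q : R[X]) :
    (p + q).contentIdeal ≤ p.contentIdeal ⊔ q.contentIdeal :=
  contentIdeal_le_iff.2 fun n => by
    rw [coeff_add]
    exact Submodule.add_mem_sup (p.coeff_mem_contentIdeal n) (q.coeff_mem_contentIdeal n)

theorem contentIdeal_sub_le (p q : R[X]) :
    (p - q).contentIdeal ≤ p.contentIdeal ⊔ q.contentIdeal :=
  contentIdeal_le_iff.2 fun n => by
    rw [coeff_sub]
    exact Submodule.sub_mem _ (mem_sup_left (p.coeff_mem_contentIdeal n))
      (mem_sup_right (q.coeff_mem_contentIdeal n))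

theorem natDegree_sub_monomial_coeff_le {p : R[X]} {n : ℕ} (hp : p.natDegree ≤ n + 1) :
    (p - monomial (n + 1) (p.coeff (n + 1))).natDegree ≤ n := by
  rw [natDegree_le_iff_coeff_eq_zero] at hp ⊢
  intro k hk
  rw [coeff_sub, coeff_monomial]
  split_ifs with h
  · simp [h]
  · simpa using hp k (by lia)

theorem contentIdeal_sub_monomial_coeff_le (p : R[X]) (n : ℕ) :
    (p - monomial n (p.coeff n)).contentIdeal ≤ p.contentIdeal := by
  refine (contentIdeal_sub_le _ _).trans (sup_le le_rfl ?_)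
  rw [contentIdeal_monomial, span_singleton_le_iff_mem]
  exact p.coeff_mem_contentIdeal n

theorem contentIdeal_sub_monomial_coeff_mul_le (p q : R[X]) (n : ℕ) :
    ((p - monomial n (p.coeff n)) * q).contentIdeal ≤
      (p * q).contentIdeal ⊔ span {p.coeff n} * q.contentIdeal := by
  rw [sub_mul]
  refine (contentIdeal_sub_le _ _).trans (sup_le_sup_left ?_ _)
  exact (contentIdeal_mul_le_mul_contentIdeal _ _).trans_eq (by rw [contentIdeal_monomial])

theorem contentIdeal_le_sub_monomial_coeff_sup (p : R[X]) (n : ℕ) :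
    p.contentIdeal ≤ (p - monomial n (p.coeff n)).contentIdeal ⊔ span {p.coeff n} := by
  have h := contentIdeal_add_le (p - monomial n (p.coeff n)) (monomial n (p.coeff n))
  rwa [sub_add_cancel, contentIdeal_monomial] at h

theorem span_singleton_mul_contentIdeal_le (a : R) (p : R[X]) :
    span {a} * p.contentIdeal ≤ (C a * p).contentIdeal := by
  rw [contentIdeal_def p, span_mul_span', span_le]
  rintro _ ⟨x, rfl, r, hr, rfl⟩
  obtain ⟨n, -, rfl⟩ := mem_coeffs_iff.1 hr
  simpa using (C x * p).coeff_mem_contentIdeal n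

/-- The **Dedekind–Mertens lemma**. -/
theorem contentIdeal_pow_succ_mul_le {m n : ℕ} {f g : R[X]}
    (hf : f.natDegree ≤ m) (hg : g.natDegree ≤ n) :
    f.contentIdeal ^ (n + 1) * g.contentIdeal ≤ f.contentIdeal ^ n * (f * g).contentIdeal := by
  induction m generalizing n f g with
  | zero =>
    rw [eq_C_of_natDegree_le_zero hf, contentIdeal_C, pow_succ, mul_assoc]
    exact mul_mono_right (span_singleton_mul_contentIdeal_le _ _)
  | succ m ihm =>
    induction n generalizing g with
    | zero =>
      rw [eq_C_of_natDegree_le_zero hg, contentIdeal_C, mul_comm f, zero_add, pow_one, pow_zero,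
        one_mul, mul_comm]
      exact span_singleton_mul_contentIdeal_le _ _
    | succ n ihn =>
      have hf' := natDegree_sub_monomial_coeff_le hf
      have hg' := natDegree_sub_monomial_coeff_le hg
      have hFF := contentIdeal_sub_monomial_coeff_le f (m + 1)
      have hF := contentIdeal_le_sub_monomial_coeff_sup f (m + 1)
      have hG := contentIdeal_le_sub_monomial_coeff_sup g (n + 1)
      have hfg := contentIdeal_sub_monomial_coeff_mul_le f g (m + 1)
      have hgf := contentIdeal_sub_monomial_coeff_mul_le g f (n + 1)
      have ih₁ := ihm hf' hg
      have ih₂ := ihn hg'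
      have hA : span {f.coeff (m + 1)} ≤ f.contentIdeal :=
        (span_singleton_le_iff_mem _).2 (f.coeff_mem_contentIdeal _)
      have hAB : span {f.coeff (m + 1)} * span {g.coeff (n + 1)} ≤ (f * g).contentIdeal := by
        rw [span_singleton_mul_span_singleton, span_singleton_le_iff_mem,
          ← coeff_mul_add_eq_of_natDegree_le hf hg]
        exact coeff_mem_contentIdeal _ _
      rw [mul_comm _ f, mul_comm g f] at hgf
      generalize (f - monomial (m + 1) (f.coeff (m + 1))) = f' at *
      generalize (g - monomial (n + 1) (g.coeff (n + 1))) = g' at *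
      generalize span {f.coeff (m + 1)} = A at *
      generalize span {g.coeff (n + 1)} = B at *
      generalize (f * g).contentIdeal = H at *
      generalize (f' * g).contentIdeal = H₁ at *
      generalize (f * g').contentIdeal = H₂ at *
      generalize f.contentIdeal = F at *
      generalize g.contentIdeal = G at *
      generalize f'.contentIdeal = F' at *
      generalize g'.contentIdeal = G' at *
      have step : A * F ^ (n + 1) * G ≤ F ^ (n + 1) * H := by
        calc A * F ^ (n + 1) * G ≤ A * F ^ (n + 1) * (G' ⊔ B) := mul_mono_right hG
          _ = A * (F ^ (n + 1) * G') ⊔ A * B * F ^ (n + 1) := by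
            rw [Ideal.mul_sup, mul_assoc, mul_right_comm]
          _ ≤ A * (F ^ n * (H ⊔ B * F)) ⊔ H * F ^ (n + 1) :=
            sup_le_sup (mul_mono_right (ih₂.trans (mul_mono_right hgf))) (mul_mono_left hAB)
          _ = F ^ n * A * H ⊔ A * B * F ^ (n + 1) ⊔ H * F ^ (n + 1) := by
            rw [Ideal.mul_sup, Ideal.mul_sup]
            congr 2 <;> ring
          _ ≤ F ^ n * F * H ⊔ H * F ^ (n + 1) ⊔ H * F ^ (n + 1) :=
            sup_le_sup_right
              (sup_le_sup (mul_mono_left (mul_mono_right hA)) (mul_mono_left hAB)) _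
          _ = F ^ (n + 1) * H := by
            rw [← pow_succ, mul_comm H, sup_idem, sup_idem]
      have hFA : F' ⊔ A = F := le_antisymm (sup_le hFF hA) hF
      have hpow : F ^ (n + 1 + 1) ≤ F' ^ (n + 1 + 1) ⊔ A * F ^ (n + 1) := by
        simpa only [hFA] using sup_pow_succ_le F' A (n + 1)
      calc F ^ (n + 1 + 1) * G ≤ (F' ^ (n + 1 + 1) ⊔ A * F ^ (n + 1)) * G := mul_mono_left hpow
        _ = F' ^ (n + 1 + 1) * G ⊔ A * F ^ (n + 1) * G := Ideal.sup_mul _ _ _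
        _ ≤ F ^ (n + 1) * (H ⊔ A * G) ⊔ A * F ^ (n + 1) * G :=
          sup_le_sup_right (ih₁.trans (mul_mono (pow_right_mono hFF _) hfg)) _
        _ = F ^ (n + 1) * H ⊔ A * F ^ (n + 1) * G := by
          rw [Ideal.mul_sup, ← mul_assoc, mul_comm (F ^ (n + 1)) A, sup_assoc, sup_idem]
        _ ≤ F ^ (n + 1) * H := sup_le le_rfl step

theorem isReductionOf_contentIdeal_mul (f g : R[X]) :
    IsReductionOf (f * g).contentIdeal (f.contentIdeal * g.contentIdeal) := by
  refine ⟨contentIdeal_mul_le_mul_contentIdeal f g, g.natDegree, ?_⟩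
  set n := g.natDegree
  calc (f.contentIdeal * g.contentIdeal) ^ (n + 1)
      = f.contentIdeal ^ (n + 1) * g.contentIdeal * g.contentIdeal ^ n := by
        rw [mul_pow, pow_succ' g.contentIdeal, mul_assoc]
    _ ≤ f.contentIdeal ^ n * (f * g).contentIdeal * g.contentIdeal ^ n :=
        mul_mono_left (contentIdeal_pow_succ_mul_le le_rfl le_rfl)
    _ = (f * g).contentIdeal * (f.contentIdeal * g.contentIdeal) ^ n := by
        rw [mul_pow]; ring

theorem isReductionOf_contentIdeal_prod {ι : Type*} (s : Finset ι) (f : ι → R[X]) :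
    IsReductionOf (∏ i ∈ s, f i).contentIdeal (∏ i ∈ s, (f i).contentIdeal) := by
  classical
  induction s using Finset.induction_on with
  | empty => simpa using IsReductionOf.refl _
  | insert a s ha ih =>
    rw [Finset.prod_insert ha, Finset.prod_insert ha]
    exact (isReductionOf_contentIdeal_mul _ _).trans (ih.mul_left _)

theorem contentIdeal_sum_monomial {n : ℕ} (a : Fin n → R) :
    (∑ k : Fin n, monomial (k : ℕ) (a k)).contentIdeal = span (Set.range a) := by
  refine le_antisymm (contentIdeal_le_iff.2 fun m => ?_) (span_le.2 ?_)
  · rw [finsetSum_coeff]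
    refine Ideal.sum_mem _ fun k _ => ?_
    rw [coeff_monomial]
    split_ifs
    · exact subset_span ⟨k, rfl⟩
    · exact zero_mem _
  · rintro _ ⟨k, rfl⟩
    have h := (∑ k : Fin n, monomial (k : ℕ) (a k)).coeff_mem_contentIdeal k
    simpa [finsetSum_coeff, coeff_monomial, Fin.val_inj] using h

theorem coeff_prod_sum_monomial {ι : Type*} [Fintype ι] [DecidableEq ι] (h : ι → ℕ)
    (a : (j : ι) → Fin (h j) → R) (ℓ : ℕ) :
    (∏ j, ∑ k : Fin (h j), monomial (k : ℕ) (a j k)).coeff ℓ =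
      ∑ f ∈ Finset.univ.filter (fun f : (j : ι) → Fin (h j) => (∑ j, (f j : ℕ)) = ℓ),
        ∏ j, a j (f j) := by
  have hprod (f : (j : ι) → Fin (h j)) :
      ∏ j, monomial (f j : ℕ) (a j (f j)) = monomial (∑ j, (f j : ℕ)) (∏ j, a j (f j)) := by
    simp only [← C_mul_X_pow_eq_monomial, Finset.prod_mul_distrib, Finset.prod_pow_eq_pow_sum,
      map_prod]
  rw [Finset.prod_univ_sum, finsetSum_coeff, Finset.sum_filter, Fintype.piFinset_univ]
  exact Finset.sum_congr rfl fun f _ => by rw [hprod, coeff_monomial]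

end Polynomial

namespace MvPolynomial

open Ideal

theorem iInf_span_X_eq_prod {K σ ι : Type*} [CommRing K] [Fintype ι] {κ : ι → Type*}
    (x : (Σ j, κ j) → σ) (hx : Function.Injective x) :
    ⨅ j, span (Set.range fun k : κ j => (X (x ⟨j, k⟩) : MvPolynomial σ K)) =
      ∏ j, span (Set.range fun k : κ j => (X (x ⟨j, k⟩) : MvPolynomial σ K)) := by
  classical
  refine le_antisymm (fun p hp => ?_) (le_iInf fun j => ?_)
  · rw [p.as_sum]
    refine Ideal.sum_mem _ fun m hm => ?_
    have hk (j : ι) : ∃ k : κ j, m (x ⟨j, k⟩) ≠ 0 := by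
      have hpj := (Submodule.mem_iInf _).1 hp j
      rw [show (Set.range fun k : κ j => (X (x ⟨j, k⟩) : MvPolynomial σ K)) =
        X '' Set.range fun k : κ j => x ⟨j, k⟩ from Set.range_comp X _,
        mem_ideal_span_X_image] at hpj
      obtain ⟨_, ⟨k, rfl⟩, hk⟩ := hpj m hm
      exact ⟨k, hk⟩
    choose k hk using hk
    have hinj : Function.Injective fun j => x ⟨j, k j⟩ := fun i j hij =>
      congrArg Sigma.fst (hx hij)
    have hle : ∑ j, Finsupp.single (x ⟨j, k j⟩) 1 ≤ m := by
      intro v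
      rw [Finsupp.finsetSum_apply]
      by_cases hv : ∃ j, x ⟨j, k j⟩ = v
      · obtain ⟨j, rfl⟩ := hv
        rw [Finset.sum_eq_single j (fun i _ hij => Finsupp.single_eq_of_ne' (hinj.ne hij))
          (by simp), Finsupp.single_eq_same]
        exact Nat.one_le_iff_ne_zero.2 (hk j)
      · rw [Finset.sum_eq_zero fun j _ => Finsupp.single_eq_of_ne' fun h => hv ⟨j, h⟩]
        exact Nat.zero_le _
    have hprod : ∏ j, (X (x ⟨j, k j⟩) : MvPolynomial σ K) =
        monomial (∑ j, Finsupp.single (x ⟨j, k j⟩) 1) 1 :=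
      (monomial_sum_one _ _).symm
    refine Ideal.mem_of_dvd _ ?_ (prod_mem_prod fun j _ => subset_span ⟨k j, rfl⟩)
    rw [hprod, monomial_dvd_monomial]
    exact ⟨Or.inr hle, one_dvd _⟩
  · exact prod_le_inf.trans (Finset.inf_le (Finset.mem_univ j))

end MvPolynomial

open MvPolynomial in
/-- A sum of Alexander duals of complete intersection monomial ideals in
pairwise disjoint sets of variables admits a reduction generated by the
union of the Schmitt–Vogel type generators of the summands. -/
theorem reduction_of_sum_of_alexander_duals
    (K : Type*) [Field K] (σ : Type*)
    (s : ℕ) (q : Fin s → ℕ) (hq : ∀ i, 1 ≤ q i)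
    (h : (i : Fin s) → Fin (q i) → ℕ) (hh : ∀ i j, 1 ≤ h i j)
    (x : (i : Fin s) → (Σ j : Fin (q i), Fin (h i j)) → σ)
    (hx : Function.Injective
      (fun p : Σ i : Fin s, Σ j : Fin (q i), Fin (h i j) => x p.1 p.2))
    (I : Fin s → Ideal (MvPolynomial σ K))
    (hI : ∀ i, I i = ⨅ j : Fin (q i),
      Ideal.span (Set.range fun k : Fin (h i j) => (X (x i ⟨j, k⟩) : MvPolynomial σ K)))
    (g : (i : Fin s) → ℕ → MvPolynomial σ K)
    (hg : ∀ i ℓ, g i ℓ = ∑ f ∈ Finset.univ.filter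
        (fun f : (j : Fin (q i)) → Fin (h i j) => (∑ j, (f j : ℕ)) = ℓ),
      ∏ j : Fin (q i), X (x i ⟨j, f j⟩))
    (J : Ideal (MvPolynomial σ K))
    (hJ : J = Ideal.span {y | ∃ i : Fin s, ∃ ℓ ≤ (∑ j, h i j) - q i, y = g i ℓ}) :
    J ≤ ∑ i, I i ∧ ∃ t : ℕ, 1 ≤ t ∧ (∑ i, I i) ^ (t + 1) = J * (∑ i, I i) ^ t := by
  have hcoeff (i : Fin s) (ℓ : ℕ) : g i ℓ =
      (∏ j, ∑ k : Fin (h i j), Polynomial.monomial (k : ℕ)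
        (X (x i ⟨j, k⟩) : MvPolynomial σ K)).coeff ℓ := by
    rw [hg, Polynomial.coeff_prod_sum_monomial]
  have hg_zero (i : Fin s) (ℓ : ℕ) (hℓ : (∑ j, h i j) - q i < ℓ) : g i ℓ = 0 := by
    rw [hg, Finset.filter_false_of_mem, Finset.sum_empty]
    intro f _ hf
    have hsum : ∑ j, ((f j : ℕ) + 1) ≤ ∑ j, h i j := Finset.sum_le_sum fun j _ => (f j).isLt
    simp only [Finset.sum_add_distrib, Finset.sum_const, Finset.card_univ, Fintype.card_fin,
      smul_eq_mul, mul_one] at hsum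
    lia
  have hJ' : J = ∑ i, (∏ j, ∑ k : Fin (h i j), Polynomial.monomial (k : ℕ)
      (X (x i ⟨j, k⟩) : MvPolynomial σ K)).contentIdeal := by
    rw [hJ, Ideal.sum_eq_sup]
    refine le_antisymm (Ideal.span_le.2 ?_) (Finset.sup_le fun i _ => ?_)
    · rintro _ ⟨i, ℓ, -, rfl⟩
      rw [hcoeff]
      exact Finset.le_sup (f := fun i => (∏ j, ∑ k : Fin (h i j), Polynomial.monomial (k : ℕ)
        (X (x i ⟨j, k⟩) : MvPolynomial σ K)).contentIdeal) (Finset.mem_univ i)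
        (Polynomial.coeff_mem_contentIdeal _ _)
    · refine Polynomial.contentIdeal_le_iff.2 fun ℓ => ?_
      rw [← hcoeff]
      rcases le_or_gt ℓ ((∑ j, h i j) - q i) with hℓ | hℓ
      · exact Ideal.subset_span ⟨i, ℓ, hℓ, rfl⟩
      · rw [hg_zero i ℓ hℓ]
        exact zero_mem _
  have hred : Ideal.IsReductionOf J (∑ i, I i) := by
    rw [hJ']
    refine Ideal.IsReductionOf.sum _ fun i _ => ?_
    have hxi : Function.Injective (x i) := fun a b hab =>
      eq_of_heq (Sigma.mk.inj (hx (a₁ := ⟨i, a⟩) (a₂ := ⟨i, b⟩) hab)).2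
    rw [hI, iInf_span_X_eq_prod (x i) hxi]
    simpa only [Polynomial.contentIdeal_sum_monomial] using
      Polynomial.isReductionOf_contentIdeal_prod Finset.univ
        fun j => ∑ k : Fin (h i j), Polynomial.monomial (k : ℕ)
          (X (x i ⟨j, k⟩) : MvPolynomial σ K)
  exact ⟨hred.1, hred.exists_pow_succ_eq⟩
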